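/- arXiv:1704.05022 — 2 statements merged into one kernel-verified Lean document; each statement's English description precedes it below -/
import Mathlib

section
/- The second-order Bagderina quantities coincide with the components of the pseudocovectorial field of weight 1 from the earlier classification: for all smooth P, Q, R, S the identities β₁ = A and β₂ = B hold identically on ℝ². -/
open Function

noncomputable section

/-- Partial derivative in the first variable. -/
def pdx (f : ℝ → ℝ → ℝ) : ℝ → ℝ → ℝ := fun x y => deriv (fun t => f t y) x

/-- Partial derivative in the second variable. -/
def pdy (f : ℝ → ℝ → ℝ) : ℝ → ℝ → ℝ := fun x y => deriv (fun t => f x t) y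

def al0 (P Q R S : ℝ → ℝ → ℝ) : ℝ → ℝ → ℝ := fun x y =>
  pdx Q x y - pdy P x y + 2 * P x y * R x y - 2 * Q x y ^ 2

def al1 (P Q R S : ℝ → ℝ → ℝ) : ℝ → ℝ → ℝ := fun x y =>
  pdx R x y - pdy Q x y + P x y * S x y - Q x y * R x y

def al2 (P Q R S : ℝ → ℝ → ℝ) : ℝ → ℝ → ℝ := fun x y =>
  pdx S x y - pdy R x y + 2 * Q x y * S x y - 2 * R x y ^ 2

def b1 (P Q R S : ℝ → ℝ → ℝ) : ℝ → ℝ → ℝ := fun x y =>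
  pdx (al1 P Q R S) x y - pdy (al0 P Q R S) x y + R x y * al0 P Q R S x y - 2 * Q x y * al1 P Q R S x y + P x y * al2 P Q R S x y

def b2 (P Q R S : ℝ → ℝ → ℝ) : ℝ → ℝ → ℝ := fun x y =>
  pdx (al2 P Q R S) x y - pdy (al1 P Q R S) x y + S x y * al0 P Q R S x y - 2 * R x y * al1 P Q R S x y + Q x y * al2 P Q R S x y

def g10 (P Q R S : ℝ → ℝ → ℝ) : ℝ → ℝ → ℝ := fun x y =>
  pdx (b1 P Q R S) x y - Q x y * b1 P Q R S x y + P x y * b2 P Q R S x y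

def g11 (P Q R S : ℝ → ℝ → ℝ) : ℝ → ℝ → ℝ := fun x y =>
  pdx (b2 P Q R S) x y - R x y * b1 P Q R S x y + Q x y * b2 P Q R S x y

def g20 (P Q R S : ℝ → ℝ → ℝ) : ℝ → ℝ → ℝ := fun x y =>
  pdy (b1 P Q R S) x y - R x y * b1 P Q R S x y + Q x y * b2 P Q R S x y

def g21 (P Q R S : ℝ → ℝ → ℝ) : ℝ → ℝ → ℝ := fun x y =>
  pdy (b2 P Q R S) x y - S x y * b1 P Q R S x y + R x y * b2 P Q R S x y

def J0 (P Q R S : ℝ → ℝ → ℝ) : ℝ → ℝ → ℝ := fun x y =>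
  b2 P Q R S x y ^ 2 * g10 P Q R S x y - b1 P Q R S x y * b2 P Q R S x y * (g20 P Q R S x y + g11 P Q R S x y) + b1 P Q R S x y ^ 2 * g21 P Q R S x y

def Gam0 (P Q R S : ℝ → ℝ → ℝ) : ℝ → ℝ → ℝ := fun x y =>
  3 * b2 P Q R S x y * g10 P Q R S x y + b1 P Q R S x y * (g20 P Q R S x y - 4 * g11 P Q R S x y)

def Gam1 (P Q R S : ℝ → ℝ → ℝ) : ℝ → ℝ → ℝ := fun x y =>
  b2 P Q R S x y * (4 * g20 P Q R S x y - g11 P Q R S x y) - 3 * b1 P Q R S x y * g21 P Q R S x y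

def d10 (P Q R S : ℝ → ℝ → ℝ) : ℝ → ℝ → ℝ := fun x y =>
  pdx (g10 P Q R S) x y - 2 * Q x y * g10 P Q R S x y + P x y * (g20 P Q R S x y + g11 P Q R S x y) - 5 * al0 P Q R S x y * b1 P Q R S x y

def d20 (P Q R S : ℝ → ℝ → ℝ) : ℝ → ℝ → ℝ := fun x y =>
  pdx (g20 P Q R S) x y - R x y * g10 P Q R S x y + P x y * g21 P Q R S x y - 4 * al1 P Q R S x y * b1 P Q R S x y - al0 P Q R S x y * b2 P Q R S x y

def d30 (P Q R S : ℝ → ℝ → ℝ) : ℝ → ℝ → ℝ := fun x y =>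
  pdy (g20 P Q R S) x y - S x y * g10 P Q R S x y + Q x y * g21 P Q R S x y - 4 * al2 P Q R S x y * b1 P Q R S x y - al1 P Q R S x y * b2 P Q R S x y

def d11 (P Q R S : ℝ → ℝ → ℝ) : ℝ → ℝ → ℝ := fun x y =>
  pdx (g11 P Q R S) x y - R x y * g10 P Q R S x y + P x y * g21 P Q R S x y - al1 P Q R S x y * b1 P Q R S x y - 4 * al0 P Q R S x y * b2 P Q R S x y

def d21 (P Q R S : ℝ → ℝ → ℝ) : ℝ → ℝ → ℝ := fun x y =>
  pdx (g21 P Q R S) x y - R x y * (g20 P Q R S x y + g11 P Q R S x y) + 2 * Q x y * g21 P Q R S x y - 5 * al1 P Q R S x y * b2 P Q R S x y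

def d31 (P Q R S : ℝ → ℝ → ℝ) : ℝ → ℝ → ℝ := fun x y =>
  pdy (g21 P Q R S) x y - S x y * (g20 P Q R S x y + g11 P Q R S x y) + 2 * R x y * g21 P Q R S x y - 5 * al2 P Q R S x y * b2 P Q R S x y

def J1 (P Q R S : ℝ → ℝ → ℝ) : ℝ → ℝ → ℝ := fun x y =>
  b2 P Q R S x y * (d20 P Q R S x y - d11 P Q R S x y) + b1 P Q R S x y * (d21 P Q R S x y - d30 P Q R S x y) + (7 / 5) * (g20 P Q R S x y - g11 P Q R S x y) ^ 2 + (3 / 5) * (g20 P Q R S x y * g11 P Q R S x y - g10 P Q R S x y * g21 P Q R S x y)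

def J2 (P Q R S : ℝ → ℝ → ℝ) : ℝ → ℝ → ℝ := fun x y =>
  Gam1 P Q R S x y * (d20 P Q R S x y - d11 P Q R S x y) + Gam0 P Q R S x y * (d21 P Q R S x y - d30 P Q R S x y) + 3 * (g20 P Q R S x y - g11 P Q R S x y) * (g10 P Q R S x y * g21 P Q R S x y - g20 P Q R S x y * g11 P Q R S x y) + (4 / 3) * (g20 P Q R S x y - g11 P Q R S x y) ^ 3

def J3 (P Q R S : ℝ → ℝ → ℝ) : ℝ → ℝ → ℝ := fun x y =>
  b2 P Q R S x y ^ 3 * d10 P Q R S x y - b1 P Q R S x y * b2 P Q R S x y ^ 2 * (2 * d20 P Q R S x y + d11 P Q R S x y) + b1 P Q R S x y ^ 2 * b2 P Q R S x y * (d30 P Q R S x y + 2 * d21 P Q R S x y) - b1 P Q R S x y ^ 3 * d31 P Q R S x y + 4 * (g20 P Q R S x y - g11 P Q R S x y) * J0 P Q R S x y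

def J4 (P Q R S : ℝ → ℝ → ℝ) : ℝ → ℝ → ℝ := fun x y =>
  -b2 P Q R S x y * (b2 P Q R S x y * Gam0 P Q R S x y + 2 * b1 P Q R S x y * Gam1 P Q R S x y) * (2 * d20 P Q R S x y + d11 P Q R S x y) + b1 P Q R S x y * (2 * b2 P Q R S x y * Gam0 P Q R S x y + b1 P Q R S x y * Gam1 P Q R S x y) * (d30 P Q R S x y + 2 * d21 P Q R S x y) + 3 * b2 P Q R S x y ^ 2 * Gam1 P Q R S x y * d10 P Q R S x y - 3 * b1 P Q R S x y ^ 2 * Gam0 P Q R S x y * d31 P Q R S x y + (66 / 5) * (g20 P Q R S x y - g11 P Q R S x y) ^ 2 * J0 P Q R S x y + (36 / 5) * (g10 P Q R S x y * g21 P Q R S x y - g20 P Q R S x y * g11 P Q R S x y) * J0 P Q R S x y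

def AA (P Q R S : ℝ → ℝ → ℝ) : ℝ → ℝ → ℝ := fun x y =>
  pdy (pdy P) x y - 2 * pdx (pdy Q) x y + pdx (pdx R) x y + 2 * P x y * pdx S x y + S x y * pdx P x y - 3 * P x y * pdy R x y - 3 * R x y * pdy P x y - 3 * Q x y * pdx R x y + 6 * Q x y * pdy Q x y

def BB (P Q R S : ℝ → ℝ → ℝ) : ℝ → ℝ → ℝ := fun x y =>
  pdx (pdx S) x y - 2 * pdx (pdy R) x y + pdy (pdy Q) x y - 2 * S x y * pdy P x y - P x y * pdy S x y + 3 * S x y * pdx Q x y + 3 * Q x y * pdx S x y + 3 * R x y * pdy Q x y - 6 * R x y * pdx R x y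

def GG (P Q R S : ℝ → ℝ → ℝ) : ℝ → ℝ → ℝ := fun x y =>
  -BB P Q R S x y * pdx (BB P Q R S) x y - 3 * AA P Q R S x y * pdy (BB P Q R S) x y + 4 * BB P Q R S x y * pdy (AA P Q R S) x y + 3 * S x y * AA P Q R S x y ^ 2 - 6 * R x y * AA P Q R S x y * BB P Q R S x y + 3 * Q x y * BB P Q R S x y ^ 2

def HH (P Q R S : ℝ → ℝ → ℝ) : ℝ → ℝ → ℝ := fun x y =>
  -AA P Q R S x y * pdy (AA P Q R S) x y - 3 * BB P Q R S x y * pdx (AA P Q R S) x y + 4 * AA P Q R S x y * pdx (BB P Q R S) x y - 3 * P x y * BB P Q R S x y ^ 2 + 6 * Q x y * AA P Q R S x y * BB P Q R S x y - 3 * R x y * AA P Q R S x y ^ 2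

def Phi (P Q R S : ℝ → ℝ → ℝ) : ℝ → ℝ → ℝ := fun x y =>
  AA P Q R S x y * BB P Q R S x y * pdy (AA P Q R S) x y + AA P Q R S x y * BB P Q R S x y * pdx (BB P Q R S) x y - AA P Q R S x y ^ 2 * pdy (BB P Q R S) x y - BB P Q R S x y ^ 2 * pdx (AA P Q R S) x y - P x y * BB P Q R S x y ^ 3 + 3 * Q x y * AA P Q R S x y * BB P Q R S x y ^ 2 - 3 * R x y * AA P Q R S x y ^ 2 * BB P Q R S x y + S x y * AA P Q R S x y ^ 3

def I3v (P Q R S F : ℝ → ℝ → ℝ) : ℝ → ℝ → ℝ := fun x y =>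
  BB P Q R S x y * (HH P Q R S x y * pdx (GG P Q R S) x y - GG P Q R S x y * pdx (HH P Q R S) x y) / (3 * F x y ^ 9) - AA P Q R S x y * (HH P Q R S x y * pdy (GG P Q R S) x y - GG P Q R S x y * pdy (HH P Q R S) x y) / (3 * F x y ^ 9) + (HH P Q R S x y * pdy F x y + GG P Q R S x y * pdx F x y) / (3 * F x y ^ 5) + BB P Q R S x y * GG P Q R S x y ^ 2 * P x y / (3 * F x y ^ 9) - (AA P Q R S x y * GG P Q R S x y ^ 2 - 2 * HH P Q R S x y * BB P Q R S x y * GG P Q R S x y) * Q x y / (3 * F x y ^ 9) + (BB P Q R S x y * HH P Q R S x y ^ 2 - 2 * HH P Q R S x y * AA P Q R S x y * GG P Q R S x y) * R x y / (3 * F x y ^ 9) - AA P Q R S x y * HH P Q R S x y ^ 2 * S x y / (3 * F x y ^ 9)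

def I6v (P Q R S F : ℝ → ℝ → ℝ) : ℝ → ℝ → ℝ := fun x y =>
  (pdy (AA P Q R S) x y - pdx (BB P Q R S) x y) / (3 * F x y ^ 2) - (AA P Q R S x y * pdy F x y - BB P Q R S x y * pdx F x y) / (3 * F x y ^ 3)

def I7v (P Q R S F : ℝ → ℝ → ℝ) : ℝ → ℝ → ℝ := fun x y =>
  (GG P Q R S x y * HH P Q R S x y * pdx (GG P Q R S) x y - GG P Q R S x y ^ 2 * pdx (HH P Q R S) x y + HH P Q R S x y ^ 2 * pdy (GG P Q R S) x y - HH P Q R S x y * GG P Q R S x y * pdy (HH P Q R S) x y) / (3 * F x y ^ 11) + (GG P Q R S x y ^ 3 * P x y + 3 * GG P Q R S x y ^ 2 * HH P Q R S x y * Q x y + 3 * GG P Q R S x y * HH P Q R S x y ^ 2 * R x y + HH P Q R S x y ^ 3 * S x y) / (3 * F x y ^ 11)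

def I8v (P Q R S F : ℝ → ℝ → ℝ) : ℝ → ℝ → ℝ := fun x y =>
  GG P Q R S x y * (AA P Q R S x y * pdx (GG P Q R S) x y + BB P Q R S x y * pdx (HH P Q R S) x y) / (3 * F x y ^ 9) + HH P Q R S x y * (AA P Q R S x y * pdy (GG P Q R S) x y + BB P Q R S x y * pdy (HH P Q R S) x y) / (3 * F x y ^ 9) - 10 * (HH P Q R S x y * pdy F x y + GG P Q R S x y * pdx F x y) / (3 * F x y ^ 5) - BB P Q R S x y * GG P Q R S x y ^ 2 * P x y / (3 * F x y ^ 9) + (AA P Q R S x y * GG P Q R S x y ^ 2 - 2 * HH P Q R S x y * BB P Q R S x y * GG P Q R S x y) * Q x y / (3 * F x y ^ 9) - (BB P Q R S x y * HH P Q R S x y ^ 2 - 2 * HH P Q R S x y * AA P Q R S x y * GG P Q R S x y) * R x y / (3 * F x y ^ 9) + AA P Q R S x y * HH P Q R S x y ^ 2 * S x y / (3 * F x y ^ 9)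

def XX (P Q R S F f : ℝ → ℝ → ℝ) : ℝ → ℝ → ℝ := fun x y =>
  (BB P Q R S x y * pdx f x y - AA P Q R S x y * pdy f x y) / F x y ^ 2

def YY (P Q R S F f : ℝ → ℝ → ℝ) : ℝ → ℝ → ℝ := fun x y =>
  (GG P Q R S x y * pdx f x y + HH P Q R S x y * pdy f x y) / F x y ^ 4

def IBgd1 (P Q R S F : ℝ → ℝ → ℝ) : ℝ → ℝ → ℝ := fun x y =>
  J1 P Q R S x y / F x y ^ 4

def IBgd2 (P Q R S F : ℝ → ℝ → ℝ) : ℝ → ℝ → ℝ := fun x y =>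
  J2 P Q R S x y / F x y ^ 6

def IBgd3 (P Q R S F : ℝ → ℝ → ℝ) : ℝ → ℝ → ℝ := fun x y =>
  -(J3 P Q R S x y / F x y ^ 7)

def IBgd4 (P Q R S F : ℝ → ℝ → ℝ) : ℝ → ℝ → ℝ := fun x y =>
  -(J4 P Q R S x y / F x y ^ 9)


/-- A partial derivative in the first variable is a directional derivative. -/
theorem pdx_eq_fderiv {f : ℝ → ℝ → ℝ} (hf : Differentiable ℝ (uncurry f)) (x y : ℝ) :
    pdx f x y = fderiv ℝ (uncurry f) (x, y) (1, 0) := by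
  have h : HasDerivAt (fun t : ℝ => (t, y)) ((1 : ℝ), (0 : ℝ)) x :=
    (hasDerivAt_id x).prodMk (hasDerivAt_const x y)
  exact ((hf (x, y)).hasFDerivAt.comp_hasDerivAt x h).deriv

/-- A partial derivative in the second variable is a directional derivative. -/
theorem pdy_eq_fderiv {f : ℝ → ℝ → ℝ} (hf : Differentiable ℝ (uncurry f)) (x y : ℝ) :
    pdy f x y = fderiv ℝ (uncurry f) (x, y) (0, 1) := by
  have h : HasDerivAt (fun t : ℝ => (x, t)) ((0 : ℝ), (1 : ℝ)) y :=
    (hasDerivAt_const y x).prodMk (hasDerivAt_id y)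
  exact ((hf (x, y)).hasFDerivAt.comp_hasDerivAt y h).deriv

theorem uncurry_pdx {f : ℝ → ℝ → ℝ} (hf : Differentiable ℝ (uncurry f)) :
    uncurry (pdx f) = fun p => fderiv ℝ (uncurry f) p (1, 0) :=
  funext fun p => pdx_eq_fderiv hf p.1 p.2

theorem uncurry_pdy {f : ℝ → ℝ → ℝ} (hf : Differentiable ℝ (uncurry f)) :
    uncurry (pdy f) = fun p => fderiv ℝ (uncurry f) p (0, 1) :=
  funext fun p => pdy_eq_fderiv hf p.1 p.2

theorem differentiable_fderiv_of_smooth {f : ℝ → ℝ → ℝ}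
    (hf : ContDiff ℝ (⊤ : ℕ∞) (uncurry f)) : Differentiable ℝ (fderiv ℝ (uncurry f)) :=
  (hf.fderiv_right (m := 1) (WithTop.coe_le_coe.2 (le_top : (1 + 1 : ℕ∞) ≤ ⊤))).differentiable one_ne_zero

theorem differentiable_of_smooth {f : ℝ → ℝ → ℝ}
    (hf : ContDiff ℝ (⊤ : ℕ∞) (uncurry f)) : Differentiable ℝ (uncurry f) :=
  hf.differentiable (by simp)

theorem differentiable_pdx {f : ℝ → ℝ → ℝ} (hf : ContDiff ℝ (⊤ : ℕ∞) (uncurry f)) :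
    Differentiable ℝ (uncurry (pdx f)) := by
  rw [uncurry_pdx (differentiable_of_smooth hf)]
  exact (differentiable_fderiv_of_smooth hf).clm_apply (differentiable_const _)

theorem differentiable_pdy {f : ℝ → ℝ → ℝ} (hf : ContDiff ℝ (⊤ : ℕ∞) (uncurry f)) :
    Differentiable ℝ (uncurry (pdy f)) := by
  rw [uncurry_pdy (differentiable_of_smooth hf)]
  exact (differentiable_fderiv_of_smooth hf).clm_apply (differentiable_const _)

/-- Mixed partial derivatives of a smooth function commute. -/
theorem pdy_pdx_comm {f : ℝ → ℝ → ℝ} (hf : ContDiff ℝ (⊤ : ℕ∞) (uncurry f)) (x y : ℝ) :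
    pdy (pdx f) x y = pdx (pdy f) x y := by
  have hd := differentiable_of_smooth hf
  have hd' := differentiable_fderiv_of_smooth hf
  rw [pdy_eq_fderiv (differentiable_pdx hf), pdx_eq_fderiv (differentiable_pdy hf),
    uncurry_pdx hd, uncurry_pdy hd,
    fderiv_clm_apply (hd' _) (differentiableAt_const _),
    fderiv_clm_apply (hd' _) (differentiableAt_const _)]
  have hs := (hf.contDiffAt (x := (x, y))).isSymmSndFDerivAt
    (by
      rw [minSmoothness_of_isRCLikeNormedField]
      exact WithTop.coe_le_coe.2 (le_top : (2 : ℕ∞) ≤ ⊤))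
  simpa using hs.eq (0, 1) (1, 0)

theorem hasDerivAt_pdx {f : ℝ → ℝ → ℝ} (hf : Differentiable ℝ (uncurry f)) (x y : ℝ) :
    HasDerivAt (fun t => f t y) (pdx f x y) x :=
  DifferentiableAt.hasDerivAt
    (hf.comp (differentiable_id.prodMk (differentiable_const y)) x)

theorem hasDerivAt_pdy {f : ℝ → ℝ → ℝ} (hf : Differentiable ℝ (uncurry f)) (x y : ℝ) :
    HasDerivAt (fun t => f x t) (pdy f x y) y :=
  DifferentiableAt.hasDerivAt
    (hf.comp ((differentiable_const x).prodMk differentiable_id) y)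

theorem stmt0 (P Q R S : ℝ → ℝ → ℝ)
    (hP : ContDiff ℝ (⊤ : ℕ∞) (uncurry P)) (hQ : ContDiff ℝ (⊤ : ℕ∞) (uncurry Q))
    (hR : ContDiff ℝ (⊤ : ℕ∞) (uncurry R)) (hS : ContDiff ℝ (⊤ : ℕ∞) (uncurry S)) :
    ∀ x y : ℝ, b1 P Q R S x y = AA P Q R S x y ∧ b2 P Q R S x y = BB P Q R S x y := by
  intro x y
  have dP := differentiable_of_smooth hP
  have dQ := differentiable_of_smooth hQ
  have dR := differentiable_of_smooth hR
  have dS := differentiable_of_smooth hS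
  have al1_x := ((((hasDerivAt_pdx (differentiable_pdx hR) x y).sub
    (hasDerivAt_pdx (differentiable_pdy hQ) x y)).add
    ((hasDerivAt_pdx dP x y).mul (hasDerivAt_pdx dS x y))).sub
    ((hasDerivAt_pdx dQ x y).mul (hasDerivAt_pdx dR x y))).deriv
  have al0_y := ((((hasDerivAt_pdy (differentiable_pdx hQ) x y).sub
    (hasDerivAt_pdy (differentiable_pdy hP) x y)).add
    (((hasDerivAt_pdy dP x y).const_mul 2).mul (hasDerivAt_pdy dR x y))).sub
    (((hasDerivAt_pdy dQ x y).pow 2).const_mul 2)).deriv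
  have al2_x := ((((hasDerivAt_pdx (differentiable_pdx hS) x y).sub
    (hasDerivAt_pdx (differentiable_pdy hR) x y)).add
    (((hasDerivAt_pdx dQ x y).const_mul 2).mul (hasDerivAt_pdx dS x y))).sub
    (((hasDerivAt_pdx dR x y).pow 2).const_mul 2)).deriv
  have al1_y := ((((hasDerivAt_pdy (differentiable_pdx hR) x y).sub
    (hasDerivAt_pdy (differentiable_pdy hQ) x y)).add
    ((hasDerivAt_pdy dP x y).mul (hasDerivAt_pdy dS x y))).sub
    ((hasDerivAt_pdy dQ x y).mul (hasDerivAt_pdy dR x y))).deriv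
  change pdx (al1 P Q R S) x y = _ at al1_x
  change pdy (al0 P Q R S) x y = _ at al0_y
  change pdx (al2 P Q R S) x y = _ at al2_x
  change pdy (al1 P Q R S) x y = _ at al1_y
  rw [pdy_pdx_comm hQ] at al0_y
  rw [pdy_pdx_comm hR] at al1_y
  constructor
  · rw [b1, AA, al1_x, al0_y, al0, al1, al2]
    push_cast
    ring
  · rw [b2, BB, al2_x, al1_y, al0, al1, al2]
    push_cast
    ring
end
end

section
/- For any two smooth vector fields obeying the commutator relationship [X, Y] = L·X − K·Y there are local rescalings that make them commute: if X, Y : ℝ² → ℝ² are smooth vector fields, p ∈ ℝ² is a point at which X p and Y p are linearly independent, and L, K : ℝ² → ℝ are smooth functions with the Lie bracket [X, Y] = L·X − K·Y on a neighborhood of p, then there exist a neighborhood U of p and smooth functions u, v : ℝ² → ℝ, nonvanishing on U, such that the Lie bracket of the vector fields (1/u)·X and (1/v)·Y vanishes at every point of U. -/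
open Function VectorField
open Set Filter Topology MeasureTheory unitInterval
open scoped ContDiff

section InverseFunction

variable {E F : Type*} [NormedAddCommGroup E] [NormedSpace ℝ E] [CompleteSpace E]
  [NormedAddCommGroup F] [NormedSpace ℝ F]

/-- The inverse function theorem for functions that are smooth on a neighbourhood: the local
inverse is smooth on a neighbourhood too. -/
theorem exists_smooth_localInverse {f : E → F} {f' : E ≃L[ℝ] F} {a : E}
    (hf : ∀ᶠ x in 𝓝 a, ContDiffAt ℝ ∞ f x) (hf' : HasFDerivAt f (f' : E →L[ℝ] F) a) :
    ∃ g : F → E, (∀ᶠ b in 𝓝 (f a), ContDiffAt ℝ ∞ g b) ∧ (∀ᶠ x in 𝓝 a, g (f x) = x) ∧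
      (∀ᶠ b in 𝓝 (f a), f (g b) = b) := by
  have hn : (∞ : WithTop ℕ∞) ≠ 0 := by simp
  set e := hf.self_of_nhds.toOpenPartialHomeomorph f hf' hn with he
  have hef : ∀ x, e x = f x := fun _ ↦ rfl
  have ha : a ∈ e.source := hf.self_of_nhds.mem_toOpenPartialHomeomorph_source hf' hn
  have hfa : f a ∈ e.target := e.map_source ha
  have hsymm : Tendsto e.symm (𝓝 (f a)) (𝓝 a) := by
    have h := e.continuousAt_symm hfa
    rwa [ContinuousAt, ← hef a, e.left_inv ha] at h
  have hcont : ContinuousAt (fderiv ℝ f) a :=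
    (hf.self_of_nhds.fderiv_right (m := 0) (by simp)).continuousAt
  have hequiv : ∀ᶠ x in 𝓝 a, ∃ A : E ≃L[ℝ] F, (A : E →L[ℝ] F) = fderiv ℝ f x := by
    refine hcont.eventually (p := fun B ↦ ∃ A : E ≃L[ℝ] F, (A : E →L[ℝ] F) = B) ?_
    rw [hf'.fderiv]
    exact ContinuousLinearEquiv.nhds f'
  refine ⟨e.symm, ?_, ?_, ?_⟩
  · filter_upwards [e.open_target.mem_nhds hfa, hsymm.eventually hf, hsymm.eventually hequiv]
      with b hb hfb ⟨A, hA⟩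
    refine e.contDiffAt_symm (f₀' := A) hb ?_ hfb
    rw [hA]
    exact (hfb.differentiableAt hn).hasFDerivAt
  · filter_upwards [e.open_source.mem_nhds ha] with x hx using e.left_inv hx
  · filter_upwards [e.open_target.mem_nhds hfa] with b hb using e.right_inv hb

end InverseFunction

section Superposition

variable {K : Type*} [TopologicalSpace K] [CompactSpace K]

/-- The pointwise evaluation of a continuous family of operators on a continuous family of
vectors, as a continuous bilinear map. -/
noncomputable def pointwiseApplyL (K : Type*) [TopologicalSpace K] [CompactSpace K]
    (E F : Type*) [NormedAddCommGroup E] [NormedSpace ℝ E]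
    [NormedAddCommGroup F] [NormedSpace ℝ F] :
    C(K, E →L[ℝ] F) →L[ℝ] C(K, E) →L[ℝ] C(K, F) :=
  LinearMap.mkContinuous₂
    (LinearMap.mk₂ ℝ (fun (A : C(K, E →L[ℝ] F)) (h : C(K, E)) ↦
        (⟨fun k ↦ A k (h k), by fun_prop⟩ : C(K, F)))
      (fun _ _ _ ↦ by ext; simp) (fun _ _ _ ↦ by ext; simp)
      (fun _ _ _ ↦ by ext; simp) (fun _ _ _ ↦ by ext; simp)) 1
    (fun A h ↦ by
      rw [ContinuousMap.norm_le _ (by positivity)]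
      intro k
      simpa using (A k).le_of_opNorm_le_of_le (A.norm_coe_le_norm k) (h.norm_coe_le_norm k))

variable {E F : Type*} [NormedAddCommGroup E] [NormedSpace ℝ E]
  [NormedAddCommGroup F] [NormedSpace ℝ F]

@[simp]
theorem pointwiseApplyL_apply (A : C(K, E →L[ℝ] F)) (h : C(K, E)) (k : K) :
    pointwiseApplyL K E F A h k = A k (h k) := rfl

/-- Composition on the left with a `C¹` map `f` is differentiable on continuous maps on a compact
space, with derivative the pointwise application of `fderiv ℝ f`. -/
theorem ContDiff.hasFDerivAt_continuousMap_comp {f : E → F} (hf : ContDiff ℝ 1 f) (α : C(K, E)) :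
    HasFDerivAt (fun β : C(K, E) ↦ (⟨f, hf.continuous⟩ : C(E, F)).comp β)
      (pointwiseApplyL K E F
        ((⟨fderiv ℝ f, hf.continuous_fderiv one_ne_zero⟩ : C(E, E →L[ℝ] F)).comp α)) α := by
  have hf' := hf.continuous_fderiv one_ne_zero
  rw [hasFDerivAt_iff_isLittleO, Asymptotics.isLittleO_iff]
  intro ε hε
  have hunif := (isCompact_range α.continuous).uniformContinuousAt_of_continuousAt (fderiv ℝ f)
    (fun _ _ ↦ hf'.continuousAt) (Metric.dist_mem_uniformity hε)
  obtain ⟨δ, hδ, hδε⟩ := Metric.mem_uniformity_dist.1 hunif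
  filter_upwards [Metric.ball_mem_nhds α hδ] with β hβ
  rw [ContinuousMap.norm_le _ (by positivity)]
  intro k
  have hk : β k ∈ Metric.ball (α k) δ := (ContinuousMap.dist_apply_le_dist k).trans_lt hβ
  have hbound : ∀ x ∈ Metric.ball (α k) δ, ‖fderiv ℝ f x - fderiv ℝ f (α k)‖ ≤ ε := by
    intro x hx
    have := hδε (a := α k) (b := x) (by rwa [dist_comm]) (mem_range_self k)
    rw [← dist_eq_norm, dist_comm]
    exact le_of_lt this
  have hmv := Convex.norm_image_sub_le_of_norm_hasFDerivWithin_le' (C := ε)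
    (fun x _ ↦ (hf.differentiable one_ne_zero x).hasFDerivAt.hasFDerivWithinAt) hbound
    (convex_ball _ _) (Metric.mem_ball_self hδ) hk
  refine hmv.trans ?_
  gcongr
  exact (β - α).norm_coe_le_norm k

end Superposition

section SuperpositionSmooth

universe u

variable {K : Type*} [TopologicalSpace K] [CompactSpace K]

theorem ContDiff.continuousMap_comp_nat (n : ℕ) {E F : Type u}
    [NormedAddCommGroup E] [NormedSpace ℝ E] [NormedAddCommGroup F] [NormedSpace ℝ F]
    {f : E → F} (hf : ContDiff ℝ n f) :
    ContDiff ℝ n (fun β : C(K, E) ↦ (⟨f, hf.continuous⟩ : C(E, F)).comp β) := by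
  induction n generalizing F with
  | zero => exact contDiff_zero.2 (ContinuousMap.continuous_postcomp _)
  | succ n ih =>
    have hf1 : ContDiff ℝ 1 f := hf.of_le (by norm_cast; omega)
    have hf' : ContDiff ℝ n (fderiv ℝ f) := hf.fderiv_right (by norm_cast)
    refine contDiff_succ_iff_hasFDerivAt.2 ?_
    exact ⟨_, (pointwiseApplyL K E F).contDiff.comp (ih hf'), hf1.hasFDerivAt_continuousMap_comp⟩

/-- Composition on the left with a smooth map is a smooth operation on continuous maps on a
compact space. -/
theorem ContDiff.continuousMap_comp {E F : Type u}
    [NormedAddCommGroup E] [NormedSpace ℝ E] [NormedAddCommGroup F] [NormedSpace ℝ F]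
    {f : E → F} (hf : ContDiff ℝ ∞ f) :
    ContDiff ℝ ∞ (fun β : C(K, E) ↦ (⟨f, hf.continuous⟩ : C(E, F)).comp β) :=
  contDiff_infty.2 fun n ↦ (hf.of_le (by exact_mod_cast le_top)).continuousMap_comp_nat n

end SuperpositionSmooth

section Primitive

variable {E : Type*} [NormedAddCommGroup E] [NormedSpace ℝ E]

/-- The operator sending a curve on the unit interval to its primitive vanishing at `0`. -/
noncomputable def primitiveL (E : Type*) [NormedAddCommGroup E] [NormedSpace ℝ E] :
    C(I, E) →L[ℝ] C(I, E) :=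
  LinearMap.mkContinuous
    { toFun := fun β ↦ ⟨fun s ↦ (s : ℝ) • ∫ r : I, β (s * r), by
        have := continuous_parametric_integral_of_continuous (μ := (volume : Measure I))
          (f := fun s r : I ↦ β (s * r)) (by fun_prop) isCompact_univ
        simp only [Measure.restrict_univ] at this
        fun_prop⟩
      map_add' := fun β γ ↦ by
        ext s
        have h (β : C(I, E)) : Integrable (fun r : I ↦ β (s * r)) :=
          Continuous.integrable_of_hasCompactSupport (by fun_prop) (HasCompactSupport.of_compactSpace _)
        simp [integral_add (h β) (h γ)]
      map_smul' := fun c β ↦ by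
        ext s
        simp [integral_smul, smul_comm c] } 1
    (fun β ↦ by
      rw [ContinuousMap.norm_le _ (by positivity)]
      intro s
      have h : ‖∫ r : I, β (s * r)‖ ≤ ‖β‖ := by
        simpa using norm_integral_le_of_norm_le_const (μ := (volume : Measure I))
          (.of_forall fun r ↦ β.norm_coe_le_norm (s * r))
      have hs : ‖(s : ℝ)‖ ≤ 1 := by simp [abs_of_nonneg s.2.1, s.2.2]
      simpa [norm_smul] using mul_le_mul hs h (norm_nonneg _) zero_le_one)

theorem primitiveL_apply (β : C(I, E)) (s : I) :
    primitiveL E β s = (s : ℝ) • ∫ r : I, β (s * r) := rfl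

theorem unitInterval_integral_eq (f : ℝ → E) : ∫ r : I, f r = ∫ r in (0 : ℝ)..1, f r := by
  rw [intervalIntegral.integral_of_le zero_le_one, ← integral_Icc_eq_integral_Ioc]
  exact integral_subtype measurableSet_Icc f

end Primitive

section Flow

variable {E : Type*} [NormedAddCommGroup E] [NormedSpace ℝ E] [CompleteSpace E]

/-- The orbits of a smooth vector field, with time rescaled so that the orbit `A (t, x)` up to time
`t` is parametrized by the unit interval, depend smoothly on `(t, x)` as elements of a Banach space
of continuous curves. The integral equation is solved by the implicit function theorem at `t = 0`;
its uniqueness part shows that the orbits for different `t` are reparametrizations of each other. -/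
theorem exists_smooth_orbits {V : E → E} (hV : ContDiff ℝ ∞ V) (x₀ : E) :
    ∃ A : ℝ × E → C(I, E), ∃ δ > 0, ∀ q ∈ Metric.ball ((0 : ℝ), x₀) δ,
      ContDiffAt ℝ ∞ A q ∧
      (∀ s : I, A q s = q.2 + q.1 • (s : ℝ) • ∫ r : I, V (A q (s * r))) ∧
      ∀ s : I, A (s * q.1, q.2) 1 = A q s := by
  let N : C(I, E) → C(I, E) := fun β ↦ (⟨V, hV.continuous⟩ : C(E, E)).comp β
  have hN : ContDiff ℝ ∞ N := hV.continuousMap_comp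
  let T : (ℝ × E) × C(I, E) → C(I, E) := fun w ↦
    w.2 - (ContinuousLinearMap.const ℝ I w.1.2 + w.1.1 • primitiveL E (N w.2))
  have hT : ContDiff ℝ ∞ T := by fun_prop
  let H : (ℝ × E) × C(I, E) → (ℝ × E) × C(I, E) := fun w ↦ (w.1, T w)
  have hH : ContDiff ℝ ∞ H := by fun_prop
  let q₀ : ℝ × E := (0, x₀)
  let α₀ : C(I, E) := ContinuousLinearMap.const ℝ I x₀
  let B : (ℝ × E) →L[ℝ] C(I, E) :=
    (ContinuousLinearMap.const ℝ I).comp (ContinuousLinearMap.snd ℝ ℝ E) +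
      (ContinuousLinearMap.fst ℝ ℝ E).smulRight (primitiveL E (N α₀))
  let H' : ((ℝ × E) × C(I, E)) ≃L[ℝ] ((ℝ × E) × C(I, E)) :=
    ContinuousLinearEquiv.equivOfInverse
      ((ContinuousLinearMap.fst ℝ _ _).prod
        (ContinuousLinearMap.snd ℝ _ _ - B.comp (ContinuousLinearMap.fst ℝ _ _)))
      ((ContinuousLinearMap.fst ℝ _ _).prod
        (ContinuousLinearMap.snd ℝ _ _ + B.comp (ContinuousLinearMap.fst ℝ _ _)))
      (fun w ↦ by simp) (fun w ↦ by simp)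
  have hTα₀ : H (q₀, α₀) = (q₀, 0) := by simp [H, T, q₀, α₀]
  have hH' : HasFDerivAt H (H' : _ →L[ℝ] _) (q₀, α₀) := by
    refine hasFDerivAt_fst.prodMk (hasFDerivAt_snd.sub ?_)
    have h1 : HasFDerivAt (fun w : (ℝ × E) × C(I, E) ↦ w.1.1)
        ((ContinuousLinearMap.fst ℝ ℝ E).comp (ContinuousLinearMap.fst ℝ _ _)) (q₀, α₀) :=
      ((ContinuousLinearMap.fst ℝ ℝ E).comp
        (ContinuousLinearMap.fst ℝ (ℝ × E) C(I, E))).hasFDerivAt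
    have h2 : HasFDerivAt (fun w : (ℝ × E) × C(I, E) ↦ ContinuousLinearMap.const ℝ I w.1.2)
        ((ContinuousLinearMap.const ℝ I).comp ((ContinuousLinearMap.snd ℝ ℝ E).comp
          (ContinuousLinearMap.fst ℝ (ℝ × E) C(I, E)))) (q₀, α₀) :=
      ((ContinuousLinearMap.const ℝ I).comp ((ContinuousLinearMap.snd ℝ ℝ E).comp
          (ContinuousLinearMap.fst ℝ (ℝ × E) C(I, E)))).hasFDerivAt
    have h3 : DifferentiableAt ℝ (fun w : (ℝ × E) × C(I, E) ↦ primitiveL E (N w.2)) (q₀, α₀) := by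
      have : ContDiff ℝ ∞ (fun w : (ℝ × E) × C(I, E) ↦ primitiveL E (N w.2)) := by fun_prop
      exact this.differentiable (by simp) _
    refine (h2.add (h1.smul h3.hasFDerivAt)).congr_fderiv (ContinuousLinearMap.ext fun w ↦ ?_)
    simp [B, q₀]
  obtain ⟨G, hG, hGH, hHG⟩ :=
    exists_smooth_localInverse (.of_forall fun _ ↦ hH.contDiffAt) hH'
  have hG₀ : G (q₀, 0) = (q₀, α₀) := hTα₀ ▸ hGH.self_of_nhds
  rw [hTα₀] at hG hHG
  let A : ℝ × E → C(I, E) := fun q ↦ (G (q, 0)).2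
  have hlim : Tendsto (fun q : ℝ × E ↦ (q, (0 : C(I, E)))) (𝓝 q₀) (𝓝 (q₀, 0)) :=
    Continuous.tendsto (by fun_prop) q₀
  have hA : ∀ᶠ q in 𝓝 q₀, ContDiffAt ℝ ∞ A q := by
    filter_upwards [hlim.eventually hG] with q hq
    exact contDiffAt_snd.comp q (hq.comp q (by fun_prop))
  have hAT : ∀ᶠ q in 𝓝 q₀, T (q, A q) = 0 := by
    filter_upwards [hlim.eventually hHG] with q hq
    have h1 : (G (q, 0)).1 = q := congrArg Prod.fst hq
    have h2 : T (G (q, 0)) = 0 := congrArg Prod.snd hq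
    rwa [← Prod.mk.eta (p := G (q, 0)), h1] at h2
  obtain ⟨ε, hε, hεG⟩ := Metric.eventually_nhds_iff_ball.1 hGH
  have hAα₀ : A q₀ = α₀ := congrArg Prod.snd hG₀
  have hAε : ∀ᶠ q in 𝓝 q₀, A q ∈ Metric.ball α₀ ε := by
    refine hA.self_of_nhds.continuousAt.eventually_mem ?_
    rw [hAα₀]
    exact Metric.ball_mem_nhds _ hε
  have huniq : ∀ q ∈ Metric.ball q₀ ε, ∀ α ∈ Metric.ball α₀ ε, T (q, α) = 0 → A q = α := by
    intro q hq α hα h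
    have h1 := hεG (q, α) (by rw [← ball_prod_same]; exact ⟨hq, hα⟩)
    have h2 : H (q, α) = (q, 0) := by simp [H, h]
    rw [h2] at h1
    exact congrArg Prod.snd h1
  obtain ⟨δ, hδ, hδA⟩ := Metric.eventually_nhds_iff_ball.1
    (hA.and (hAT.and (hAε.and (Metric.ball_mem_nhds q₀ hε))))
  have heq : ∀ q ∈ Metric.ball q₀ δ, ∀ s : I,
      A q s = q.2 + q.1 • (s : ℝ) • ∫ r : I, V (A q (s * r)) := by
    intro q hq s
    have := congrArg (fun α : C(I, E) ↦ α s) (hδA q hq).2.1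
    simp only [T, ContinuousMap.sub_apply, ContinuousMap.add_apply, ContinuousMap.smul_apply,
      primitiveL_apply, ContinuousMap.zero_apply, sub_eq_zero] at this
    exact this
  refine ⟨A, δ, hδ, fun q hq ↦ ⟨(hδA q hq).1, heq q hq, fun s ↦ ?_⟩⟩
  let γ : C(I, E) := ⟨fun r ↦ A q (s * r), by fun_prop⟩
  have hsq : (s * q.1, q.2) ∈ Metric.ball q₀ ε := by
    have : q ∈ Metric.ball q₀ ε := (hδA q hq).2.2.2
    rw [← Prod.mk.eta (p := q), ← ball_prod_same] at this
    rw [← ball_prod_same]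
    refine ⟨?_, this.2⟩
    have h1 : |q.1| < ε := by simpa using this.1
    have h2 : |(s : ℝ) * q.1| ≤ |q.1| := by
      rw [abs_mul, abs_of_nonneg s.2.1]
      exact mul_le_of_le_one_left (abs_nonneg _) s.2.2
    simpa using h2.trans_lt h1
  have hγ : γ ∈ Metric.ball α₀ ε := by
    have hAq : A q ∈ Metric.ball α₀ ε := (hδA q hq).2.2.1
    rw [Metric.mem_ball, ContinuousMap.dist_lt_iff hε] at hAq ⊢
    exact fun r ↦ hAq (s * r)
  rw [huniq _ hsq γ hγ]
  · simp [γ]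
  · ext r
    simp only [T, ContinuousMap.sub_apply, ContinuousMap.add_apply, ContinuousMap.smul_apply,
      primitiveL_apply, ContinuousMap.zero_apply, sub_eq_zero]
    change A q (s * r) = q.2 + (s * q.1) • (r : ℝ) • ∫ r' : I, V (A q (s * (r * r')))
    rw [heq q hq]
    simp only [smul_smul, mul_assoc, Icc.coe_mul]
    congr 2
    ring

/-- A smooth vector field on a Banach space has a local flow that is jointly smooth in time and
initial condition. -/
theorem exists_smooth_flow {V : E → E} (hV : ContDiff ℝ ∞ V) (x₀ : E) :
    ∃ φ : ℝ × E → E, (∀ᶠ q in 𝓝 ((0 : ℝ), x₀), ContDiffAt ℝ ∞ φ q) ∧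
      (∀ᶠ q in 𝓝 ((0 : ℝ), x₀), HasDerivAt (fun t ↦ φ (t, q.2)) (V (φ q)) q.1) ∧
      ∀ᶠ x in 𝓝 x₀, φ (0, x) = x := by
  obtain ⟨A, δ, hδ, hA⟩ := exists_smooth_orbits hV x₀
  let φ : ℝ × E → E := fun q ↦ A q 1
  have hφ : ∀ q ∈ Metric.ball ((0 : ℝ), x₀) δ, ContDiffAt ℝ ∞ φ q := fun q hq ↦
    (ContinuousMap.evalCLM ℝ (M := E) (1 : I)).contDiff.contDiffAt.comp q (hA q hq).1
  have hint : ∀ q ∈ Metric.ball ((0 : ℝ), x₀) δ,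
      φ q = q.2 + ∫ r in (0 : ℝ)..q.1, V (φ (r, q.2)) := by
    intro q hq
    obtain ⟨-, h1, h2⟩ := hA q hq
    have h3 : φ q = q.2 + q.1 • ∫ r : I, V (φ (q.1 * r, q.2)) := by
      simpa [φ, mul_comm q.1, h2] using h1 1
    rw [h3, unitInterval_integral_eq (fun r ↦ V (φ (q.1 * r, q.2))),
      intervalIntegral.smul_integral_comp_mul_left (fun r ↦ V (φ (r, q.2)))]
    simp
  have hball : Metric.ball ((0 : ℝ), x₀) δ ∈ 𝓝 ((0 : ℝ), x₀) := Metric.ball_mem_nhds _ hδ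
  refine ⟨φ, eventually_of_mem hball hφ, eventually_of_mem hball fun q hq ↦ ?_, ?_⟩
  · have hmem : ∀ t ∈ Metric.ball (0 : ℝ) δ, (t, q.2) ∈ Metric.ball ((0 : ℝ), x₀) δ := by
      intro t ht
      rw [← Prod.mk.eta (p := q), ← ball_prod_same] at hq
      rw [← ball_prod_same]
      exact ⟨ht, hq.2⟩
    have hq1 : q.1 ∈ Metric.ball (0 : ℝ) δ := by
      rw [← Prod.mk.eta (p := q), ← ball_prod_same] at hq
      exact hq.1
    have hcont : ContinuousOn (fun t ↦ V (φ (t, q.2))) (Metric.ball (0 : ℝ) δ) := fun t ht ↦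
      (hV.continuous.continuousAt.comp (f := fun t ↦ φ (t, q.2)) <|
        (hφ _ (hmem t ht)).continuousAt.comp (f := fun t : ℝ ↦ (t, q.2))
          (by fun_prop)).continuousWithinAt
    have hsub : uIcc 0 q.1 ⊆ Metric.ball (0 : ℝ) δ :=
      (convex_ball (0 : ℝ) δ).ordConnected.uIcc_subset (Metric.mem_ball_self hδ) hq1
    have hder := (intervalIntegral.integral_hasDerivAt_right
      ((hcont.mono hsub).intervalIntegrable)
      (hcont.stronglyMeasurableAtFilter Metric.isOpen_ball _ hq1)
      (hcont.continuousAt (Metric.isOpen_ball.mem_nhds hq1))).const_add q.2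
    refine hder.congr_of_eventuallyEq ?_
    filter_upwards [Metric.isOpen_ball.mem_nhds hq1] with t ht using hint _ (hmem t ht)
  · filter_upwards [Metric.ball_mem_nhds x₀ hδ] with x hx
    have := hint (0, x) (by rw [← ball_prod_same]; exact ⟨Metric.mem_ball_self hδ, hx⟩)
    simpa using this

end Flow

/-- Near a point where the smooth planar field `V` is transverse to `w`, the equation `V f = g`
has a smooth solution. -/
theorem exists_local_solution {V : ℝ × ℝ → ℝ × ℝ} (hV : ContDiff ℝ ∞ V) {g : ℝ × ℝ → ℝ}
    (hg : ContDiff ℝ ∞ g) {p w : ℝ × ℝ} (hind : LinearIndependent ℝ ![V p, w]) :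
    ∃ f : ℝ × ℝ → ℝ, ContDiff ℝ ∞ f ∧ ∀ᶠ q in 𝓝 p, fderiv ℝ f q (V q) = g q := by
  obtain ⟨φ, hφ, hφV, hφ₀⟩ := exists_smooth_flow (E := (ℝ × ℝ) × ℝ)
    (V := fun z ↦ (V z.1, g z.1)) (by fun_prop) (p, 0)
  let c : ℝ × ℝ → ℝ × ((ℝ × ℝ) × ℝ) := fun y ↦ (y.1, (p + y.2 • w, 0))
  have hc : ContDiff ℝ ∞ c := by fun_prop
  have hc₀ : c 0 = (0, (p, 0)) := by simp [c]
  have hclim : Tendsto c (𝓝 0) (𝓝 (0, (p, 0))) := hc₀ ▸ hc.continuous.tendsto 0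
  let ψ : ℝ × ℝ → ℝ × ℝ := fun y ↦ (φ (c y)).1
  let Z : ℝ × ℝ → ℝ := fun y ↦ (φ (c y)).2
  have hφc : ∀ᶠ y in 𝓝 0, ContDiffAt ℝ ∞ (fun y ↦ φ (c y)) y := by
    filter_upwards [hclim.eventually hφ] with y hy using hy.comp y hc.contDiffAt
  have hψ : ∀ᶠ y in 𝓝 0, ContDiffAt ℝ ∞ ψ y := by
    filter_upwards [hφc] with y hy using hy.fst
  have hZ : ∀ᶠ y in 𝓝 0, ContDiffAt ℝ ∞ Z y := by
    filter_upwards [hφc] with y hy using hy.snd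
  have hn : (∞ : WithTop ℕ∞) ≠ 0 := by simp
  have hline (y : ℝ × ℝ) : HasDerivAt (fun t : ℝ ↦ (t, y.2)) ((1 : ℝ), (0 : ℝ)) y.1 :=
    (hasDerivAt_id _).prodMk (hasDerivAt_const _ _)
  have hψt : ∀ᶠ y in 𝓝 0, fderiv ℝ ψ y (1, 0) = V (ψ y) := by
    filter_upwards [hψ, hclim.eventually hφV] with y hy hyV
    have h1 := (hy.differentiableAt hn).hasFDerivAt.comp_hasDerivAt y.1 (hline y)
    exact h1.unique (hasFDerivAt_fst.comp_hasDerivAt y.1 hyV)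
  have hZt : ∀ᶠ y in 𝓝 0, fderiv ℝ Z y (1, 0) = g (ψ y) := by
    filter_upwards [hZ, hclim.eventually hφV] with y hy hyV
    have h1 := (hy.differentiableAt hn).hasFDerivAt.comp_hasDerivAt y.1 (hline y)
    exact h1.unique (hasFDerivAt_snd.comp_hasDerivAt y.1 hyV)
  have hψ₀ : ∀ᶠ s in 𝓝 (0 : ℝ), ψ (0, s) = p + s • w := by
    have h : Tendsto (fun s : ℝ ↦ (p + s • w, (0 : ℝ))) (𝓝 0) (𝓝 (p, 0)) := by
      have : Continuous (fun s : ℝ ↦ (p + s • w, (0 : ℝ))) := by fun_prop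
      simpa using this.tendsto 0
    filter_upwards [h.eventually hφ₀] with s hs
    simp [ψ, c, hs]
  have hψp : ψ 0 = p := hψ₀.self_of_nhds.trans (by simp)
  have hψs : fderiv ℝ ψ 0 (0, 1) = w := by
    have h1 := (hψ.self_of_nhds.differentiableAt hn).hasFDerivAt.comp_hasDerivAt (0 : ℝ)
      (f := fun s : ℝ ↦ ((0 : ℝ), s)) ((hasDerivAt_const _ _).prodMk (hasDerivAt_id _))
    have h2 : HasDerivAt (fun s : ℝ ↦ p + s • w) w 0 := by
      simpa using ((hasDerivAt_id (0 : ℝ)).smul_const w).const_add p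
    exact h1.unique (h2.congr_of_eventuallyEq hψ₀)
  have hψ't := hψt.self_of_nhds
  rw [hψp] at hψ't
  have hinj : Injective (fderiv ℝ ψ 0) := by
    rw [injective_iff_map_eq_zero]
    rintro ⟨a, b⟩ hab
    have h : a • V p + b • w = 0 := by
      rw [← hψ't, ← hψs, ← map_smul, ← map_smul, ← map_add]
      simpa using hab
    obtain ⟨rfl, rfl⟩ := LinearIndependent.pair_iff.1 hind a b h
    rfl
  let ψ' : (ℝ × ℝ) ≃L[ℝ] (ℝ × ℝ) :=
    (LinearEquiv.ofInjectiveEndo (fderiv ℝ ψ 0 : (ℝ × ℝ) →ₗ[ℝ] (ℝ × ℝ))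
      hinj).toContinuousLinearEquiv
  have hψ' : HasFDerivAt ψ (ψ' : (ℝ × ℝ) →L[ℝ] (ℝ × ℝ)) 0 := by
    have : (ψ' : (ℝ × ℝ) →L[ℝ] (ℝ × ℝ)) = fderiv ℝ ψ 0 := ContinuousLinearMap.ext fun _ ↦ rfl
    rw [this]
    exact (hψ.self_of_nhds.differentiableAt hn).hasFDerivAt
  obtain ⟨G, hG, hGψ, hψG⟩ := exists_smooth_localInverse hψ hψ'
  have hGp : G (ψ 0) = 0 := hGψ.self_of_nhds
  have hGlim : Tendsto G (𝓝 p) (𝓝 0) := by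
    have := hG.self_of_nhds.continuousAt.tendsto
    rwa [hGp, hψp] at this
  rw [hψp] at hG hψG
  have hf : ∀ᶠ q in 𝓝 p, ContDiffAt ℝ ∞ (fun q ↦ Z (G q)) q := by
    filter_upwards [hG, hGlim.eventually hZ] with q hq hZq using hZq.comp q hq
  have hfV : ∀ᶠ q in 𝓝 p, fderiv ℝ (fun q ↦ Z (G q)) q (V q) = g q := by
    filter_upwards [hf, hψG, hGlim.eventually hψ, hGlim.eventually hψt, hGlim.eventually hZt,
      hGlim.eventually hGψ.eventually_nhds] with q hfq hψGq hψq hψtq hZtq hGψq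
    rw [hψGq] at hψtq hZtq
    have hd : DifferentiableAt ℝ (fun q ↦ Z (G q)) (ψ (G q)) := by
      rw [hψGq]; exact hfq.differentiableAt hn
    have h1 : (fun y ↦ Z (G (ψ y))) =ᶠ[𝓝 (G q)] Z := by
      filter_upwards [hGψq] with y hy using by rw [hy]
    have h2 := fderiv_comp (G q) hd (hψq.differentiableAt hn)
    rw [← hψtq, ← hZtq, ← h1.fderiv_eq]
    rw [hψGq] at h2
    exact (DFunLike.congr_fun h2 (1, 0)).symm
  obtain ⟨ε, hε, hεf⟩ := Metric.eventually_nhds_iff_ball.1 hf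
  let χ : ContDiffBump p := ⟨ε / 3, ε / 2, by positivity, by linarith⟩
  have hχ : (fun q ↦ χ q * Z (G q)) =ᶠ[𝓝 p] fun q ↦ Z (G q) := by
    filter_upwards [χ.eventuallyEq_one] with q hq
    simp [hq]
  refine ⟨fun q ↦ χ q * Z (G q), contDiff_iff_contDiffAt.2 fun q ↦ ?_, ?_⟩
  · by_cases hq : q ∈ Metric.ball p ε
    · exact χ.contDiff.contDiffAt.mul (hεf q hq)
    · have hq' : q ∉ tsupport χ := by
        rw [χ.tsupport_eq]
        intro h
        exact hq (Metric.closedBall_subset_ball (by simp [χ]; linarith) h)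
      refine contDiffAt_const (c := 0) |>.congr_of_eventuallyEq ?_
      filter_upwards [notMem_tsupport_iff_eventuallyEq.1 hq'] with y hy
      simp [hy]
  · filter_upwards [hfV, hχ.eventually_nhds] with q hq hχq
    rw [Filter.EventuallyEq.fderiv_eq hχq, hq]

/-- For any two smooth vector fields on the plane obeying the commutator relationship
`[X, Y] = L·X − K·Y` near a point of linear independence, there are local rescalings
`(1/u)·X`, `(1/v)·Y` that commute. -/
theorem stmt8 (X Y : ℝ × ℝ → ℝ × ℝ)
    (hX : ContDiff ℝ (⊤ : ℕ∞) X) (hY : ContDiff ℝ (⊤ : ℕ∞) Y)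
    (p : ℝ × ℝ) (hind : LinearIndependent ℝ ![X p, Y p])
    (L K : ℝ × ℝ → ℝ) (hL : ContDiff ℝ (⊤ : ℕ∞) L) (hK : ContDiff ℝ (⊤ : ℕ∞) K)
    (hbr : ∀ᶠ q in nhds p, lieBracket ℝ X Y q = L q • X q - K q • Y q) :
    ∃ U ∈ nhds p, ∃ u v : ℝ × ℝ → ℝ, ContDiff ℝ (⊤ : ℕ∞) u ∧ ContDiff ℝ (⊤ : ℕ∞) v ∧
      (∀ q ∈ U, u q ≠ 0 ∧ v q ≠ 0) ∧
      ∀ q ∈ U, lieBracket ℝ (fun r => (u r)⁻¹ • X r) (fun r => (v r)⁻¹ • Y r) q = 0 := by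
  have hn : (∞ : WithTop ℕ∞) ≠ 0 := by simp
  obtain ⟨a, ha, haK⟩ := exists_local_solution hX hK hind
  obtain ⟨b, hb, hbL⟩ := exists_local_solution hY hL (LinearIndependent.pair_symm_iff.1 hind)
  refine ⟨_, hbr.and (haK.and hbL), fun q ↦ Real.exp (-b q), fun q ↦ Real.exp (-a q),
    hb.neg.exp, ha.neg.exp, fun q _ ↦ ⟨(Real.exp_pos _).ne', (Real.exp_pos _).ne'⟩, ?_⟩
  rintro q ⟨hq, hqa, hqb⟩
  have hda := (ha.differentiable hn q).hasFDerivAt.exp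
  have hdb := (hb.differentiable hn q).hasFDerivAt.exp
  have hXq := hX.differentiable hn q
  have hYq := hY.differentiable hn q
  simp only [Real.exp_neg, inv_inv]
  rw [lieBracket_smul_left hdb.differentiableAt hXq,
    lieBracket_smul_right hda.differentiableAt hYq, hq, hda.fderiv, hdb.fderiv]
  simp only [_root_.smul_apply, map_smul, hqa, hqb]
  module
end
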